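/- Let K be an algebraically closed field of characteristic 0, let c ≥ 4 be an even integer, let A_c be the explicit c×(2c+2) matrix of linear forms in x, y, t defined in the context, let S = K[x,y,t], and let M_c = {v ∈ S^{2c+2} : A_c·v = 0} be the graded syzygy module of A_c. Then there exist homogeneous elements v₁, …, v_{c+2} ∈ M_c of degree 1 and homogeneous elements w₁, w₂ ∈ M_c of degree c/2 which generate M_c as an S-module, and such that the module of relations {(f₁,…,f_{c+2},g₁,g₂) ∈ S^{c+4} : Σ f_iv_i + g₁w₁ + g₂w₂ = 0} is a free S-module of rank 2 generated by two relations with the f_i homogeneous of degree c/2 and g₁, g₂ homogeneous of degree 1. (This is the even case of Proposition 20: E_c has the minimal free resolution 0 → O(−(c+2)/2)² → O(−c/2)² ⊕ O(−1)^{c+2} → E_c → 0.) -/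

import Mathlib

open Matrix MvPolynomial

/-- Column index (1-based) of the `x` entry of row `j` of the matrix `A_c`:
`(p₁,p₂,p_j) = (1,4,2j+1)`. -/
def pcol (j : ℕ) : ℕ := if j = 1 then 1 else if j = 2 then 4 else 2 * j + 1

/-- Column index (1-based) of the `y` entry of row `j` of the matrix `A_c`:
`(q₁,q₂,q_j) = (2,5,2j+2)`. -/
def qcol (j : ℕ) : ℕ := pcol j + 1

/-- The entry of the matrix `A_c` in (1-based) row `i` and column `j`, evaluated at
`(x, y, t) = (p 0, p 1, p 2)`. -/
def AcEnt {R : Type*} [CommRing R] (p : Fin 3 → R) (i j : ℕ) : R :=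
  if i ≤ 2 then
    (if j = pcol i then p 0 else 0) + (if j = qcol i then p 1 else 0) +
      (if j = qcol i + 1 then p 2 else 0)
  else
    (if j = 2 * i + 1 then p 0 else 0) + (if j = 2 * i + 2 then p 1 else 0) +
      (if j = pcol (i - 2) then p 2 else 0) + (if j = qcol (i - 1) then p 2 else 0)

/-- The explicit `c × (2c+2)` matrix `A_c` of Example 9, evaluated at
`(x, y, t) = (p 0, p 1, p 2)`. -/
def Ac {R : Type*} [CommRing R] (c : ℕ) (p : Fin 3 → R) :
    Matrix (Fin c) (Fin (2 * c + 2)) R :=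
  fun i j => AcEnt p ((i : ℕ) + 1) ((j : ℕ) + 1)

/-- The matrix `A_c` as a matrix of linear forms over `S = K[x,y,t]`,
with `(x, y, t) = (X 0, X 1, X 2)`. -/
noncomputable def AcPoly (K : Type*) [Field K] (c : ℕ) :
    Matrix (Fin c) (Fin (2 * c + 2)) (MvPolynomial (Fin 3) K) :=
  Ac c (fun k => MvPolynomial.X k)

/-- The graded syzygy module `M_c = {v ∈ S^{2c+2} : A_c·v = 0}` as an `S`-submodule of
`S^{2c+2}`, `S = K[x,y,t]`. -/
noncomputable def syzMod (K : Type*) [Field K] (c : ℕ) :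
    Submodule (MvPolynomial (Fin 3) K) (Fin (2 * c + 2) → MvPolynomial (Fin 3) K) :=
  LinearMap.ker (AcPoly K c).mulVecLin

section
variable {S : Type*} [CommRing S] [IsDomain S]

theorem kos1 (x y : S) (hx : Prime x) (hxy : ¬ x ∣ y) (a b : S) (h : x * a + y * b = 0) :
    ∃ g, a = y * g ∧ b = -(x * g) := by
  have h1 : x ∣ y * b := ⟨-a, by linear_combination h⟩
  rcases hx.dvd_or_dvd h1 with h2 | ⟨g, hg⟩
  · exact absurd h2 hxy
  · refine ⟨-g, ?_, by rw [hg]; ring⟩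
    apply mul_left_cancel₀ hx.ne_zero
    rw [hg] at h
    linear_combination h

/-- `P = x + t z²`. -/
noncomputable def pP (x t : S) : Polynomial S :=
  Polynomial.C x + Polynomial.C t * Polynomial.X ^ 2
/-- `Q = y + t z`. -/
noncomputable def pQ (y t : S) : Polynomial S :=
  Polynomial.C y + Polynomial.C t * Polynomial.X

theorem kosN (x y t : S) (hx : Prime x) (hxy : ¬ x ∣ y) (n : ℕ) : ∀ (a b : Polynomial S),
    Polynomial.X ^ n ∣ pP x t * a + pQ y t * b →
    ∃ g h1 h2, a = pQ y t * g + Polynomial.X ^ n * h1 ∧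
      b = -(pP x t * g) + Polynomial.X ^ n * h2 := by
  induction n with
  | zero => intro a b _; exact ⟨0, a, b, by simp, by simp⟩
  | succ n ih =>
    rintro a b ⟨h, hh⟩
    have h0 := congrArg (fun p => Polynomial.coeff p 0) hh
    simp [pP, pQ, Polynomial.mul_coeff_zero] at h0
    obtain ⟨g0, ha, hb⟩ := kos1 x y hx hxy _ _ h0
    have ha' : Polynomial.X ∣ a - pQ y t * Polynomial.C g0 := by
      rw [Polynomial.X_dvd_iff]; simp [pQ, Polynomial.mul_coeff_zero, ha]
    have hb' : Polynomial.X ∣ b + pP x t * Polynomial.C g0 := by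
      rw [Polynomial.X_dvd_iff]; simp [pP, Polynomial.mul_coeff_zero, hb]
    obtain ⟨a', ha'⟩ := ha'
    obtain ⟨b', hb'⟩ := hb'
    obtain ⟨g, h1, h2, e1, e2⟩ := ih a' b' ⟨h, by
      apply mul_left_cancel₀ (Polynomial.X_ne_zero (R := S))
      linear_combination hh - pP x t * ha' - pQ y t * hb'⟩
    refine ⟨Polynomial.C g0 + Polynomial.X * g, h1, h2, ?_, ?_⟩
    · linear_combination ha' + Polynomial.X * e1
    · linear_combination hb' + Polynomial.X * e2

theorem genN (x y t : S) (hx : Prime x) (hxy : ¬ x ∣ y)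
    (hT : ∀ (j : ℕ) (a b u : S), x * a + y * b + t ^ j * u = 0 → ∃ r s, u = x * r + y * s)
    (k : ℕ) : ∀ (j : ℕ) (a b h : Polynomial S) (u0 u1 : S),
    pP x t * a + pQ y t * b + Polynomial.C (t ^ j) * (Polynomial.C u0 + Polynomial.C u1 * Polynomial.X)
      = Polynomial.X ^ (2 * k) * h →
    ∃ α β g0 g1, u0 = α * y + β * x + x ^ k * g0 ∧ u1 = α * t - β * y + x ^ k * g1 := by
  induction k with
  | zero => intro j a b h u0 u1 _; exact ⟨0, 0, u0, u1, by simp, by simp⟩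
  | succ k ih =>
    intro j a b h u0 u1 hh
    have h0 := congrArg (fun p => Polynomial.coeff p 0) hh
    have h1 := congrArg (fun p => Polynomial.coeff p 1) hh
    have e : Polynomial.X ^ (2 * (k + 1)) * h = Polynomial.X * (Polynomial.X * (Polynomial.X ^ (2 * k) * h)) := by ring
    simp only [e] at h0 h1
    simp [pP, pQ, Polynomial.mul_coeff_zero, add_mul, mul_assoc, pow_two, -map_pow] at h0
    simp [pP, pQ, add_mul, mul_assoc, pow_two, Polynomial.coeff_X_mul, Polynomial.coeff_C, -map_pow] at h1
    obtain ⟨r, s, hu0⟩ := hT j (a.coeff 0) (b.coeff 0) u0 (by linear_combination h0)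
    obtain ⟨g, hg1, hg2⟩ := kos1 x y hx hxy (a.coeff 0 + t ^ j * r) (b.coeff 0 + t ^ j * s)
      (by linear_combination h0 - t ^ j * hu0)
    obtain ⟨r', s', hu1⟩ := hT j (a.coeff 1 - t * g) (b.coeff 1) (u1 - t * s)
      (by linear_combination h1 - t * hg2)
    have E : pP x t * (a - Polynomial.C (t ^ j * s') + Polynomial.C (t ^ j) *
          (Polynomial.C (r + s') + Polynomial.C r' * Polynomial.X)) +
        pQ y t * (b + Polynomial.C (t ^ j * s) + Polynomial.C (t ^ j * s') * Polynomial.X)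
        = Polynomial.X ^ 2 * (Polynomial.X ^ (2 * k) * h + Polynomial.C (t ^ (j + 1)) *
          (Polynomial.C (r + s') + Polynomial.C r' * Polynomial.X)) := by
      have hu1' : u1 = t * s + (x * r' + y * s') := by linear_combination hu1
      rw [hu0, hu1'] at hh
      simp only [pP, pQ, map_add, map_mul, map_pow] at hh ⊢
      linear_combination hh
    obtain ⟨G, H1, H2, E1, E2⟩ := kosN x y t hx hxy 2 _ _ ⟨_, E⟩
    rw [E1, E2] at E
    obtain ⟨α, β, g0, g1, i0, i1⟩ := ih (j + 1) (-H1) (-H2) (-h) (r + s') r' (by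
      apply mul_left_cancel₀ (pow_ne_zero 2 (Polynomial.X_ne_zero (R := S)))
      linear_combination -E)
    refine ⟨s + x * α, -s' + x * β, g0, g1, ?_, ?_⟩
    · linear_combination hu0 + x * i0
    · linear_combination hu1 + x * i1

/-- `A = Σ x^i (-t z²)^(k-1-i)`. -/
noncomputable def pA (x t : S) (k : ℕ) : Polynomial S :=
  ∑ i ∈ Finset.range k, Polynomial.C x ^ i * (-(Polynomial.C t * Polynomial.X ^ 2)) ^ (k - 1 - i)

theorem pA_mul (x t : S) (k : ℕ) : pP x t * pA x t k =
    Polynomial.C (x ^ k) - Polynomial.X ^ (2 * k) * Polynomial.C ((-t) ^ k) := by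
  have := (Commute.all (Polynomial.C x) (-(Polynomial.C t * Polynomial.X ^ 2))).mul_geom_sum₂ k
  have e : pP x t = Polynomial.C x - (-(Polynomial.C t * Polynomial.X ^ 2)) := by
    simp [pP]
  rw [e, pA, this, neg_mul_eq_neg_mul, mul_pow]
  rw [← pow_mul, map_pow, map_pow, map_neg]; ring

theorem P_cancel (x t : S) (hx : x ≠ 0) (n : ℕ) : ∀ (f : Polynomial S),
    Polynomial.X ^ n ∣ pP x t * f → Polynomial.X ^ n ∣ f := by
  induction n with
  | zero => simp
  | succ n ih =>
    rintro f ⟨h, hh⟩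
    have h0 := congrArg (fun p => Polynomial.coeff p 0) hh
    simp [pP, Polynomial.mul_coeff_zero, hx] at h0
    obtain ⟨f', rfl⟩ := Polynomial.X_dvd_iff.2 h0
    rw [pow_succ']
    apply mul_dvd_mul_left
    refine ih f' ⟨h, ?_⟩
    apply mul_left_cancel₀ (Polynomial.X_ne_zero (R := S))
    linear_combination hh

theorem rel_lem (x y t : S) (hx : Prime x) (hxy : ¬ x ∣ y) (k : ℕ) (α β g0 g1 : S)
    (h0 : -(α * y) + β * x + g0 * x ^ k = 0) (h1 : -(α * t) - β * y + g1 * x ^ k = 0) :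
    ∃ α' β', α = x ^ k * α' ∧ β = x ^ k * β' ∧ g0 = α' * y - β' * x ∧ g1 = α' * t + β' * y := by
  have hq : ¬ x ∣ (y ^ 2 + x * t) := by
    intro h
    rw [dvd_add_left (dvd_mul_right _ _)] at h
    exact hxy (hx.dvd_of_dvd_pow h)
  obtain ⟨β', hβ⟩ := hx.pow_dvd_of_dvd_mul_right k hq
    (a := β) ⟨-(t * g0 - y * g1), by linear_combination t * h0 - y * h1⟩
  obtain ⟨α', hα⟩ := hx.pow_dvd_of_dvd_mul_right k hxy
    (a := α) ⟨β' * x + g0, by rw [hβ] at h0; linear_combination -h0⟩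
  have hk := pow_ne_zero k hx.ne_zero
  refine ⟨α', β', hα, hβ, ?_, ?_⟩
  · apply mul_left_cancel₀ hk
    rw [hα, hβ] at h0; linear_combination h0
  · apply mul_left_cancel₀ hk
    rw [hα, hβ] at h1; linear_combination h1

/-- All coefficients are homogeneous of degree `d`. -/
def HomP {K : Type*} [Field K] (d : ℕ) (p : Polynomial (MvPolynomial (Fin 3) K)) : Prop :=
  ∀ i, (p.coeff i).IsHomogeneous d

namespace HomP
variable {K : Type*} [Field K] {d e : ℕ} {p q : Polynomial (MvPolynomial (Fin 3) K)}
theorem add (hp : HomP d p) (hq : HomP d q) : HomP d (p + q) := fun i => by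
  rw [Polynomial.coeff_add]; exact (hp i).add (hq i)
theorem neg (hp : HomP d p) : HomP d (-p) := fun i => by
  rw [Polynomial.coeff_neg]; exact (hp i).neg
theorem zero : HomP d (0 : Polynomial (MvPolynomial (Fin 3) K)) := fun i => by
  rw [Polynomial.coeff_zero]; exact MvPolynomial.isHomogeneous_zero _ _ _
theorem mul (hp : HomP d p) (hq : HomP e q) : HomP (d + e) (p * q) := fun i => by
  rw [Polynomial.coeff_mul]
  exact MvPolynomial.IsHomogeneous.sum _ _ _ fun j _ => (hp _).mul (hq _)
theorem C {r : MvPolynomial (Fin 3) K} (h : r.IsHomogeneous d) : HomP d (Polynomial.C r) :=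
  fun i => by
    rw [Polynomial.coeff_C]; split_ifs
    · exact h
    · exact MvPolynomial.isHomogeneous_zero _ _ _
theorem X : HomP 0 (Polynomial.X : Polynomial (MvPolynomial (Fin 3) K)) := fun i => by
  rw [Polynomial.coeff_X]; split_ifs
  · exact MvPolynomial.isHomogeneous_one _ _
  · exact MvPolynomial.isHomogeneous_zero _ _ _
theorem pow (hp : HomP d p) (n : ℕ) : HomP (n * d) (p ^ n) := by
  induction n with
  | zero => rw [pow_zero, zero_mul]; exact C (MvPolynomial.isHomogeneous_one _ _)
  | succ n ih => rw [pow_succ, add_mul, one_mul]; exact ih.mul hp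
theorem Xpow (n : ℕ) : HomP 0 (Polynomial.X ^ n : Polynomial (MvPolynomial (Fin 3) K)) := by
  simpa using X.pow (K := K) n
theorem sum {ι : Type*} (s : Finset ι) (f : ι → Polynomial (MvPolynomial (Fin 3) K))
    (h : ∀ i ∈ s, HomP d (f i)) : HomP d (∑ i ∈ s, f i) := fun i => by
  rw [Polynomial.finsetSum_coeff]
  exact MvPolynomial.IsHomogeneous.sum _ _ _ fun j hj => h j hj i
theorem cast (hp : HomP d p) (h : d = e) : HomP e p := h ▸ hp
end HomP

section
variable {K : Type*} [Field K]
theorem hX (i : Fin 3) : (MvPolynomial.X i : MvPolynomial (Fin 3) K).IsHomogeneous 1 :=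
  MvPolynomial.isHomogeneous_X _ _
theorem homP_P : HomP 1 (pP (MvPolynomial.X 0 : MvPolynomial (Fin 3) K) (MvPolynomial.X 2)) :=
  (HomP.C (hX 0)).add ((HomP.C (hX 2)).mul (HomP.Xpow 2))
theorem homP_Q : HomP 1 (pQ (MvPolynomial.X 1 : MvPolynomial (Fin 3) K) (MvPolynomial.X 2)) :=
  (HomP.C (hX 1)).add ((HomP.C (hX 2)).mul HomP.X)
theorem homP_A (k : ℕ) : HomP (k - 1)
    (pA (MvPolynomial.X 0 : MvPolynomial (Fin 3) K) (MvPolynomial.X 2) k) := by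
  apply HomP.sum
  intro i hi
  have : i < k := by simpa using hi
  refine (((HomP.C (hX 0)).pow i).mul
    (((HomP.C (hX 2)).mul (HomP.Xpow 2)).neg.pow (k - 1 - i))).cast (by omega)
theorem homP_tA (k : ℕ) (hk : 1 ≤ k) : HomP k
    (Polynomial.C (MvPolynomial.X 2) * 
      pA (MvPolynomial.X 0 : MvPolynomial (Fin 3) K) (MvPolynomial.X 2) k) :=
  ((HomP.C (hX 2)).mul (homP_A k)).cast (by omega)

theorem not_X_dvd : ¬ (MvPolynomial.X 0 : MvPolynomial (Fin 3) K) ∣ MvPolynomial.X 1 := by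
  rw [MvPolynomial.X_dvd_X]; simp

theorem hT_lem (j : ℕ) (a b u : MvPolynomial (Fin 3) K)
    (h : MvPolynomial.X 0 * a + MvPolynomial.X 1 * b + MvPolynomial.X 2 ^ j * u = 0) :
    ∃ r s, u = MvPolynomial.X 0 * r + MvPolynomial.X 1 * s := by
  let ρ : MvPolynomial (Fin 3) K →ₐ[K] MvPolynomial (Fin 3) K :=
    MvPolynomial.aeval ![0, 0, MvPolynomial.X 2]
  have key : ∀ p : MvPolynomial (Fin 3) K,
      ∃ r s, p = ρ p + MvPolynomial.X 0 * r + MvPolynomial.X 1 * s := by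
    intro p
    induction p using MvPolynomial.induction_on with
    | C a => exact ⟨0, 0, by simp [ρ]⟩
    | add p q hp hq =>
      obtain ⟨r, s, h⟩ := hp
      obtain ⟨r', s', h'⟩ := hq
      exact ⟨r + r', s + s', by rw [map_add]; linear_combination h + h'⟩
    | mul_X p i hp =>
      obtain ⟨r, s, h⟩ := hp
      rw [map_mul]
      fin_cases i
      · exact ⟨p, 0, by simp [ρ]; ring⟩
      · exact ⟨0, p, by simp [ρ]; ring⟩
      · refine ⟨r * MvPolynomial.X 2, s * MvPolynomial.X 2, ?_⟩
        simp [ρ] at h ⊢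
        linear_combination MvPolynomial.X 2 * h
  have h' := congrArg ρ h
  simp only [map_add, map_mul, map_pow, map_zero] at h'
  simp [ρ] at h'
  obtain ⟨r, s, hrs⟩ := key u
  refine ⟨r, s, ?_⟩
  have : ρ u = 0 := h'
  rw [this] at hrs
  linear_combination hrs
end
end

section
variable {S : Type*} [CommRing S]

/-- The entries of the vector attached to `(a, b, u0 + u1 z)`. -/
def vecN (a b : Polynomial S) (u0 u1 : S) (n : ℕ) : S :=
  if n = 0 then a.coeff 0 else if n = 1 then b.coeff 0 else if n = 2 then u0 else
  if n = 3 then a.coeff 1 else if n = 4 then b.coeff 1 else if n = 5 then u1 + b.coeff 0 else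
  if n % 2 = 0 then a.coeff (n / 2 - 1) else b.coeff (n / 2 - 1)

/-- The linear map `(a, b, u0, u1) ↦` vector. -/
def vecL (c : ℕ) : (Polynomial S × Polynomial S × S × S) →ₗ[S] (Fin (2 * c + 2) → S) where
  toFun p := fun j => vecN p.1 p.2.1 p.2.2.1 p.2.2.2 j
  map_add' p q := by
    funext j
    simp only [vecN, Pi.add_apply, Prod.fst_add, Prod.snd_add, Polynomial.coeff_add]
    split_ifs <;> ring
  map_smul' r p := by
    funext j
    simp only [vecN, Pi.smul_apply, Prod.smul_fst, Prod.smul_snd, Polynomial.coeff_smul,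
      RingHom.id_apply]
    split_ifs <;> simp [mul_add]

theorem sum_single (N m : ℕ) (hm : m < N) (r : S) (f : ℕ → S) :
    ∑ j ∈ Finset.range N, (if j + 1 = m + 1 then r else 0) * f j = r * f m := by
  rw [Finset.sum_eq_single m]
  · simp
  · intro b _ hb
    rw [if_neg (by omega), zero_mul]
  · intro h
    exact absurd (Finset.mem_range.2 hm) h

theorem vecN_even (a b : Polynomial S) (u0 u1 : S) (i : ℕ) (hi : 2 ≤ i) :
    vecN a b u0 u1 (2 * i + 2) = a.coeff i := by
  unfold vecN
  rw [if_neg (by omega), if_neg (by omega), if_neg (by omega), if_neg (by omega),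
    if_neg (by omega), if_neg (by omega), if_pos (by omega)]
  congr 1; omega

theorem vecN_odd (a b : Polynomial S) (u0 u1 : S) (i : ℕ) (hi : 2 ≤ i) :
    vecN a b u0 u1 (2 * i + 3) = b.coeff i := by
  unfold vecN
  rw [if_neg (by omega), if_neg (by omega), if_neg (by omega), if_neg (by omega),
    if_neg (by omega), if_neg (by omega), if_neg (by omega)]
  congr 1; omega

theorem vecN_p (a b : Polynomial S) (u0 u1 : S) (i : ℕ) :
    vecN a b u0 u1 (pcol (i + 1) - 1) = a.coeff i := by
  rcases i with _ | _ | i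
  · simp [pcol, vecN]
  · simp [pcol, vecN]
  · have : pcol (i + 1 + 1 + 1) - 1 = 2 * (i + 1 + 1) + 2 := by simp [pcol]; omega
    rw [this, vecN_even _ _ _ _ _ (by omega)]

theorem vecN_q (a b : Polynomial S) (u0 u1 : S) (i : ℕ) :
    vecN a b u0 u1 (qcol (i + 1) - 1) = b.coeff i := by
  rcases i with _ | _ | i
  · simp [qcol, pcol, vecN]
  · simp [qcol, pcol, vecN]
  · have : qcol (i + 1 + 1 + 1) - 1 = 2 * (i + 1 + 1) + 3 := by simp [qcol, pcol]; omega
    rw [this, vecN_odd _ _ _ _ _ (by omega)]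

theorem sum_col (N m : ℕ) (hm : m ≤ N) (hm1 : 1 ≤ m) (r : S) (f : ℕ → S) :
    ∑ j ∈ Finset.range N, (if j + 1 = m then r else 0) * f j = r * f (m - 1) := by
  obtain ⟨m, rfl⟩ : ∃ n, m = n + 1 := ⟨m - 1, by omega⟩
  exact sum_single N m (by omega) r f

theorem pcol_le (i : ℕ) (h : 1 ≤ i) : 1 ≤ pcol i ∧ pcol i ≤ 2 * i + 1 := by
  unfold pcol; split_ifs <;> omega

theorem row_eq (p : Fin 3 → S) (c i : ℕ) (hi : i < c) (hc : 2 ≤ c) (a b : Polynomial S) (u0 u1 : S) :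
    ∑ j ∈ Finset.range (2 * c + 2), AcEnt p (i + 1) (j + 1) * vecN a b u0 u1 j =
      (pP (p 0) (p 2) * a + pQ (p 1) (p 2) * b +
        Polynomial.C (p 2) * (Polynomial.C u0 + Polynomial.C u1 * Polynomial.X)).coeff i := by
  have hp := pcol_le (i + 1) (by omega)
  rcases i with _ | _ | i
  · simp only [AcEnt, zero_add, show (1 : ℕ) ≤ 2 by omega, if_true, add_mul, Finset.sum_add_distrib]
    rw [sum_col _ _ (by simp [pcol]), sum_col _ _ (by simp [qcol, pcol]; try omega),
      sum_col _ _ (by simp [qcol, pcol]; try omega)]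
    · simp [pcol, qcol, vecN, pP, pQ, Polynomial.mul_coeff_zero]
    all_goals simp [qcol, pcol]
  · simp only [AcEnt, zero_add, show (1 + 1 : ℕ) ≤ 2 by omega, if_true, add_mul,
      Finset.sum_add_distrib]
    rw [sum_col _ _ (by simp [pcol]; try omega), sum_col _ _ (by simp [qcol, pcol]; try omega),
      sum_col _ _ (by simp [qcol, pcol]; try omega)]
    · simp [pcol, qcol, vecN, pP, pQ, add_mul, mul_assoc, pow_two, Polynomial.coeff_X_mul,
        Polynomial.coeff_C]
      ring
    all_goals simp [qcol, pcol]
  · have h1 := pcol_le (i + 1) (by omega)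
    have h2 := pcol_le (i + 1 + 1) (by omega)
    simp only [AcEnt, show ¬ (i + 1 + 1 + 1 : ℕ) ≤ 2 by omega, if_false, add_mul,
      Finset.sum_add_distrib]
    rw [show i + 1 + 1 + 1 - 2 = i + 1 by omega, show i + 1 + 1 + 1 - 1 = (i + 1) + 1 by omega]
    rw [sum_col _ _ (by omega) (by omega), sum_col _ _ (by omega) (by omega),
      sum_col _ _ (by omega) (by omega),
      sum_col _ _ (by unfold qcol; omega) (by unfold qcol; omega), vecN_p, vecN_q]
    rw [show 2 * (i + 1 + 1 + 1) + 1 - 1 = 2 * (i + 1 + 1) + 2 by omega,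
      show 2 * (i + 1 + 1 + 1) + 2 - 1 = 2 * (i + 1 + 1) + 3 by omega,
      vecN_even _ _ _ _ _ (by omega), vecN_odd _ _ _ _ _ (by omega)]
    simp [pP, pQ, add_mul, mul_assoc, pow_two, Polynomial.coeff_X_mul,
        Polynomial.coeff_C]
    ring

theorem vecL_surj (c : ℕ) (hc : 2 ≤ c) (v : Fin (2 * c + 2) → S) : ∃ p, vecL c p = v := by
  let w : ℕ → S := fun n => if h : n < 2 * c + 2 then v ⟨n, h⟩ else 0
  let a : Polynomial S := ∑ i ∈ Finset.range c, Polynomial.monomial i (w (pcol (i + 1) - 1))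
  let b : Polynomial S := ∑ i ∈ Finset.range c, Polynomial.monomial i (w (qcol (i + 1) - 1))
  have ha : ∀ i < c, a.coeff i = w (pcol (i + 1) - 1) := by
    intro i hi
    simp [a, Polynomial.finsetSum_coeff, Polynomial.coeff_monomial, hi]
  have hb : ∀ i < c, b.coeff i = w (qcol (i + 1) - 1) := by
    intro i hi
    simp [b, Polynomial.finsetSum_coeff, Polynomial.coeff_monomial, hi]
  refine ⟨(a, b, w 2, w 5 - b.coeff 0), ?_⟩
  have key : ∀ n < 2 * c + 2, vecN a b (w 2) (w 5 - b.coeff 0) n = w n := by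
    intro n hn
    unfold vecN
    split_ifs with h0 h1 h2 h3 h4 h5 h6
    · subst h0; rw [ha _ (by omega)]; simp [pcol]
    · subst h1; rw [hb _ (by omega)]; simp [qcol, pcol]
    · subst h2; rfl
    · subst h3; rw [ha _ (by omega)]; simp [pcol]
    · subst h4; rw [hb _ (by omega)]; simp [qcol, pcol]
    · subst h5; ring
    · rw [ha _ (by omega)]; congr 1; unfold pcol
      rw [if_neg (by omega), if_neg (by omega)]; omega
    · rw [hb _ (by omega)]; congr 1; unfold qcol pcol
      rw [if_neg (by omega), if_neg (by omega)]; omega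
  funext j
  have := key j j.2
  simpa [vecL, w] using this

theorem vecL_zero_iff (c : ℕ) (hc : 2 ≤ c) (a b : Polynomial S) (u0 u1 : S) :
    vecL c (a, b, u0, u1) = 0 ↔
      Polynomial.X ^ c ∣ a ∧ Polynomial.X ^ c ∣ b ∧ u0 = 0 ∧ u1 = 0 := by
  rw [Polynomial.X_pow_dvd_iff, Polynomial.X_pow_dvd_iff]
  constructor
  · intro h
    have h' : ∀ n < 2 * c + 2, vecN a b u0 u1 n = 0 := fun n hn => congrFun h ⟨n, hn⟩
    have hb : ∀ d < c, b.coeff d = 0 := by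
      intro d hd
      rw [← vecN_q a b u0 u1 d]
      have := pcol_le (d + 1) (by omega)
      exact h' _ (by unfold qcol; omega)
    refine ⟨?_, hb, h' 2 (by omega), ?_⟩
    · intro d hd
      rw [← vecN_p a b u0 u1 d]
      have := pcol_le (d + 1) (by omega)
      exact h' _ (by omega)
    · have := h' 5 (by omega)
      simpa [vecN, hb 0 (by omega)] using this
  · rintro ⟨ha, hb, rfl, rfl⟩
    funext j
    have := j.2
    simp only [vecL, LinearMap.coe_mk, AddHom.coe_mk, vecN, Pi.zero_apply]
    rw [hb 0 (by omega)]
    split_ifs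
    all_goals first
      | rfl
      | exact ha _ (by omega)
      | exact hb _ (by omega)
      | simp
end

section
variable {K : Type*} [Field K]

theorem vecL_mem_iff (c : ℕ) (hc : 2 ≤ c) (a b : Polynomial (MvPolynomial (Fin 3) K))
    (u0 u1 : MvPolynomial (Fin 3) K) : vecL c (a, b, u0, u1) ∈ syzMod K c ↔
      Polynomial.X ^ c ∣ pP (MvPolynomial.X 0) (MvPolynomial.X 2) * a +
        pQ (MvPolynomial.X 1) (MvPolynomial.X 2) * b +
        Polynomial.C (MvPolynomial.X 2) *
          (Polynomial.C u0 + Polynomial.C u1 * Polynomial.X) := by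
  have key : ∀ i : Fin c, (AcPoly K c).mulVecLin (vecL c (a, b, u0, u1)) i =
      (pP (MvPolynomial.X 0) (MvPolynomial.X 2) * a +
        pQ (MvPolynomial.X 1) (MvPolynomial.X 2) * b +
        Polynomial.C (MvPolynomial.X 2) *
          (Polynomial.C u0 + Polynomial.C u1 * Polynomial.X)).coeff i := by
    intro i
    rw [← row_eq (fun k => (MvPolynomial.X k : MvPolynomial (Fin 3) K)) c i i.2 hc,
      ← Fin.sum_univ_eq_sum_range
        (fun j => AcEnt (fun k => (MvPolynomial.X k : MvPolynomial (Fin 3) K)) (i + 1) (j + 1) *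
          vecN a b u0 u1 j)]
    rfl
  rw [Polynomial.X_pow_dvd_iff, syzMod, LinearMap.mem_ker]
  constructor
  · intro h d hd
    rw [← key ⟨d, hd⟩, h]; rfl
  · intro h
    funext i
    rw [key]; exact h i i.2

theorem vecL_hom (c d : ℕ) (a b : Polynomial (MvPolynomial (Fin 3) K))
    (u0 u1 : MvPolynomial (Fin 3) K) (ha : HomP d a) (hb : HomP d b)
    (h0 : u0.IsHomogeneous d) (h1 : u1.IsHomogeneous d) (j) :
    vecL c (a, b, u0, u1) j ∈ homogeneousSubmodule (Fin 3) K d := by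
  rw [mem_homogeneousSubmodule]
  simp only [vecL, LinearMap.coe_mk, AddHom.coe_mk, vecN]
  split_ifs
  all_goals first
    | exact ha _
    | exact hb _
    | assumption
    | exact h1.add (hb _)
end


section
variable {S : Type*} [CommRing S]

/-- Preimages of the `c + 2` generators of degree 1. -/
noncomputable def gp (x y t : S) (c : ℕ) (k : Fin (c + 2)) : Polynomial S × Polynomial S × S × S :=
  if (k : ℕ) < c then
    (Polynomial.X ^ (k : ℕ) * pQ y t, -(Polynomial.X ^ (k : ℕ) * pP x t), 0, 0)
  else if (k : ℕ) = c then (0, Polynomial.C t, -y, -t)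
  else (-Polynomial.C t, Polynomial.C t * Polynomial.X, x, -y)

/-- Preimages of the two generators of degree `c / 2`. -/
noncomputable def wp (x t : S) (k : ℕ) (m : Fin 2) : Polynomial S × Polynomial S × S × S :=
  if m = 0 then (-(Polynomial.C t * pA x t k), 0, x ^ k, 0)
  else (-(Polynomial.C t * pA x t k * Polynomial.X), 0, 0, x ^ k)

/-- Coefficient vectors. -/
def fn (c : ℕ) (g : Polynomial S) (α β : S) (k : Fin (c + 2)) : S :=
  if (k : ℕ) < c then g.coeff k else if (k : ℕ) = c then α else β

/-- The polynomial attached to a coefficient vector. -/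
noncomputable def fpoly (c : ℕ) (f : Fin (c + 2) → S) : Polynomial S :=
  ∑ i : Fin c, Polynomial.C (f i.castSucc.castSucc) * Polynomial.X ^ (i : ℕ)

theorem fpoly_coeff (c : ℕ) (f : Fin (c + 2) → S) (i : Fin c) :
    (fpoly c f).coeff i = f i.castSucc.castSucc := by
  simp only [fpoly, Polynomial.finsetSum_coeff, Polynomial.coeff_C_mul, Polynomial.coeff_X_pow]
  rw [Finset.sum_eq_single i]
  · simp
  · intro b _ hb
    rw [if_neg (fun h => hb (Fin.ext h.symm)), mul_zero]
  · simp

theorem fn_fpoly (c : ℕ) (f : Fin (c + 2) → S) (g : Polynomial S)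
    (h : Polynomial.X ^ c ∣ fpoly c f - g) :
    f = fn c g (f ⟨c, by omega⟩) (f ⟨c + 1, by omega⟩) := by
  rw [Polynomial.X_pow_dvd_iff] at h
  funext k
  unfold fn
  split_ifs with h1 h2
  · have := h k h1
    rw [Polynomial.coeff_sub, sub_eq_zero] at this
    rw [← this, fpoly_coeff c f ⟨k, h1⟩]
    rfl
  · congr 1; exact Fin.ext h2
  · congr 1; apply Fin.ext; have := k.2; simp; omega

theorem fpoly_fn (c : ℕ) (g : Polynomial S) (α β : S) :
    Polynomial.X ^ c ∣ fpoly c (fn c g α β) - g := by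
  rw [Polynomial.X_pow_dvd_iff]
  intro d hd
  rw [Polynomial.coeff_sub, fpoly_coeff c _ ⟨d, hd⟩]
  simp [fn, hd]

theorem comb_eq (x y t : S) (c k : ℕ) (f : Fin (c + 2) → S) (g : Fin 2 → S) :
    (∑ i, f i • vecL c (gp x y t c i)) + (∑ m, g m • vecL c (wp x t k m)) =
    vecL c (fpoly c f * pQ y t - Polynomial.C (f ⟨c + 1, by omega⟩ * t)
        - Polynomial.C t * pA x t k * (Polynomial.C (g 0) + Polynomial.C (g 1) * Polynomial.X),
      -(fpoly c f * pP x t) + Polynomial.C (f ⟨c, by omega⟩ * t)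
        + Polynomial.C (f ⟨c + 1, by omega⟩ * t) * Polynomial.X,
      -(f ⟨c, by omega⟩ * y) + f ⟨c + 1, by omega⟩ * x + g 0 * x ^ k,
      -(f ⟨c, by omega⟩ * t) - f ⟨c + 1, by omega⟩ * y + g 1 * x ^ k) := by
  simp only [← map_smul, ← map_sum, ← map_add]
  congr 1
  rw [Fin.sum_univ_castSucc, Fin.sum_univ_castSucc, Fin.sum_univ_two]
  have e1 : ∀ i : Fin c, gp x y t c i.castSucc.castSucc =
    (Polynomial.X ^ (i : ℕ) * pQ y t, -(Polynomial.X ^ (i : ℕ) * pP x t), 0, 0) := by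
    intro i; simp [gp]
  have e2 : gp x y t c (Fin.last c).castSucc = (0, Polynomial.C t, -y, -t) := by
    simp [gp]
  have e3 : gp x y t c (Fin.last (c + 1)) =
      (-Polynomial.C t, Polynomial.C t * Polynomial.X, x, -y) := by
    simp [gp]
  have e4 : (Fin.last c).castSucc = (⟨c, by omega⟩ : Fin (c + 2)) := rfl
  have e5 : Fin.last (c + 1) = (⟨c + 1, by omega⟩ : Fin (c + 2)) := rfl
  simp only [e1, e2, e3]
  rw [e4, e5]
  have e6 : ∑ i : Fin c, f i.castSucc.castSucc • ((Polynomial.X ^ (i : ℕ) * pQ y t,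
      -(Polynomial.X ^ (i : ℕ) * pP x t), 0, 0) : Polynomial S × Polynomial S × S × S) =
      (fpoly c f * pQ y t, -(fpoly c f * pP x t), 0, 0) := by
    refine Prod.ext ?_ (Prod.ext ?_ (Prod.ext ?_ ?_))
    all_goals simp only [Prod.fst_sum, Prod.snd_sum, Prod.smul_mk, fpoly, Finset.sum_mul,
      smul_zero, Finset.sum_const_zero, ← Finset.sum_neg_distrib, Polynomial.smul_eq_C_mul,
      mul_neg, mul_assoc]
  rw [e6]
  simp only [wp, if_true, one_ne_zero, if_false, Prod.smul_mk, Prod.mk_add_mk,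
    Polynomial.smul_eq_C_mul, smul_eq_mul, Prod.mk.injEq, map_mul]
  refine ⟨?_, ?_, ?_, ?_⟩ <;> ring
end

set_option maxHeartbeats 4000000 in
/-- **Proposition 20, even case.** For even `c ≥ 4` the syzygy module `M_c` of `A_c` is
generated by `c+2` syzygies of degree 1 and two syzygies of degree `c/2`, whose module
of relations is free of rank two, generated by two relations with coefficients
homogeneous of degrees `c/2` and `1`: this is the minimal free resolution
`0 → O(−(c+2)/2)² → O(−c/2)² ⊕ O(−1)^{c+2} → E_c → 0`. -/
theorem stmt14 {K : Type*} [Field K] [IsAlgClosed K] [CharZero K]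
    (c : ℕ) (hc : 4 ≤ c) (heven : Even c) :
    ∃ (v : Fin (c + 2) → (Fin (2 * c + 2) → MvPolynomial (Fin 3) K))
      (w : Fin 2 → (Fin (2 * c + 2) → MvPolynomial (Fin 3) K)),
      (∀ k j, v k j ∈ homogeneousSubmodule (Fin 3) K 1) ∧
      (∀ m j, w m j ∈ homogeneousSubmodule (Fin 3) K (c / 2)) ∧
      (∀ k, v k ∈ syzMod K c) ∧ (∀ m, w m ∈ syzMod K c) ∧
      Submodule.span (MvPolynomial (Fin 3) K) (Set.range v ∪ Set.range w) = syzMod K c ∧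
      ∃ (F : Fin 2 → Fin (c + 2) → MvPolynomial (Fin 3) K)
        (G : Fin 2 → Fin 2 → MvPolynomial (Fin 3) K),
        (∀ l k, F l k ∈ homogeneousSubmodule (Fin 3) K (c / 2)) ∧
        (∀ l m, G l m ∈ homogeneousSubmodule (Fin 3) K 1) ∧
        (∀ l, (∑ k, F l k • v k) + (∑ m, G l m • w m) = 0) ∧
        (∀ a : Fin 2 → MvPolynomial (Fin 3) K,
          a 0 • F 0 + a 1 • F 1 = 0 ∧ a 0 • G 0 + a 1 • G 1 = 0 → a = 0) ∧
        (∀ (f : Fin (c + 2) → MvPolynomial (Fin 3) K)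
           (g : Fin 2 → MvPolynomial (Fin 3) K),
          (∑ k, f k • v k) + (∑ m, g m • w m) = 0 →
            ∃ a : Fin 2 → MvPolynomial (Fin 3) K,
              f = a 0 • F 0 + a 1 • F 1 ∧ g = a 0 • G 0 + a 1 • G 1) := by
  obtain ⟨k, hk⟩ : ∃ k, c = 2 * k := by
    obtain ⟨r, hr⟩ := heven
    exact ⟨r, by omega⟩
  have hck : c / 2 = k := by omega
  have hk1 : 1 ≤ k := by omega
  have hc2 : 2 ≤ c := by omega
  rw [hck]
  let x : MvPolynomial (Fin 3) K := MvPolynomial.X 0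
  let y : MvPolynomial (Fin 3) K := MvPolynomial.X 1
  let t : MvPolynomial (Fin 3) K := MvPolynomial.X 2
  have hx : Prime x := MvPolynomial.X_prime
  have hxy : ¬ x ∣ y := not_X_dvd
  have hxk : x ^ k ≠ 0 := pow_ne_zero k hx.ne_zero
  have hpA : pP x t * pA x t k = Polynomial.C (x ^ k) -
      Polynomial.X ^ c * Polynomial.C ((-t) ^ k) := by
    rw [hk]; exact pA_mul x t k
  have hxkh : (x ^ k).IsHomogeneous k := by simpa using (hX (K := K) 0).pow k
  have h0h : ∀ d, (0 : MvPolynomial (Fin 3) K).IsHomogeneous d :=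
    fun d => MvPolynomial.isHomogeneous_zero _ _ _
  have hv : ∀ i, vecL c (gp x y t c i) ∈ syzMod K c := by
    intro i
    unfold gp
    split_ifs
    · rw [vecL_mem_iff c hc2]
      refine ⟨0, ?_⟩
      simp only [map_zero]
      ring
    · rw [vecL_mem_iff c hc2]
      refine ⟨0, ?_⟩
      change pP x t * 0 + pQ y t * Polynomial.C t + Polynomial.C t *
        (Polynomial.C (-y) + Polynomial.C (-t) * Polynomial.X) = _
      simp only [pQ, map_neg]
      ring
    · rw [vecL_mem_iff c hc2]
      refine ⟨0, ?_⟩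
      change pP x t * (-Polynomial.C t) + pQ y t * (Polynomial.C t * Polynomial.X) + Polynomial.C t *
        (Polynomial.C x + Polynomial.C (-y) * Polynomial.X) = _
      simp only [pP, pQ, map_neg]
      ring
  have hw : ∀ m, vecL c (wp x t k m) ∈ syzMod K c := by
    intro m
    unfold wp
    split_ifs
    · rw [vecL_mem_iff c hc2]
      refine ⟨Polynomial.C t * Polynomial.C ((-t) ^ k), ?_⟩
      change pP x t * _ + pQ y t * _ + Polynomial.C t * _ = _
      rw [map_zero]
      linear_combination (-Polynomial.C t) * hpA
    · rw [vecL_mem_iff c hc2]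
      refine ⟨Polynomial.C t * Polynomial.C ((-t) ^ k) * Polynomial.X, ?_⟩
      change pP x t * _ + pQ y t * _ + Polynomial.C t * _ = _
      rw [map_zero]
      linear_combination (-Polynomial.C t) * Polynomial.X * hpA
  refine ⟨fun i => vecL c (gp x y t c i), fun m => vecL c (wp x t k m), ?_, ?_, hv, hw, ?_, ?_⟩
  · intro i j
    simp only [gp]
    split_ifs
    · exact vecL_hom c 1 _ _ _ _ (((HomP.Xpow _).mul homP_Q).cast (by omega))
        (((HomP.Xpow _).mul homP_P).cast (by omega)).neg (h0h _) (h0h _) j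
    · exact vecL_hom c 1 _ _ _ _ HomP.zero (HomP.C (hX 2)) (hX 1).neg (hX 2).neg j
    · exact vecL_hom c 1 _ _ _ _ (HomP.C (hX 2)).neg ((HomP.C (hX 2)).mul HomP.X)
        (hX 0) (hX 1).neg j
  · intro m j
    simp only [wp]
    split_ifs
    · exact vecL_hom c k _ _ _ _ (homP_tA k hk1).neg HomP.zero hxkh (h0h _) j
    · exact vecL_hom c k _ _ _ _ ((homP_tA k hk1).mul HomP.X).neg HomP.zero (h0h _) hxkh j
  · apply le_antisymm
    · rw [Submodule.span_le]
      rintro _ (⟨i, rfl⟩ | ⟨m, rfl⟩)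
      · exact hv i
      · exact hw m
    · intro v hvm
      obtain ⟨⟨a, b, u0, u1⟩, rfl⟩ := vecL_surj c hc2 v
      rw [vecL_mem_iff c hc2] at hvm
      obtain ⟨h, hh⟩ := hvm
      change pP x t * a + pQ y t * b + Polynomial.C t *
        (Polynomial.C u0 + Polynomial.C u1 * Polynomial.X) = _ at hh
      obtain ⟨α, β, g0, g1, hu0, hu1⟩ := genN x y t hx hxy hT_lem k 1 a b h u0 u1
        (by rw [pow_one, ← hk]; exact hh)
      obtain ⟨g, h1, h2, e1, e2⟩ := kosN x y t hx hxy c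
        (a + Polynomial.C (β * t) + Polynomial.C t * pA x t k *
          (Polynomial.C g0 + Polynomial.C g1 * Polynomial.X))
        (b + Polynomial.C (α * t) - Polynomial.C (β * t) * Polynomial.X)
        ⟨h - Polynomial.C ((-t) ^ k) * Polynomial.C t *
          (Polynomial.C g0 + Polynomial.C g1 * Polynomial.X), by
          rw [hu0, hu1] at hh
          simp only [map_add, map_sub, map_mul] at hh ⊢
          have hP : pP x t = Polynomial.C x + Polynomial.C t * Polynomial.X ^ 2 := rfl
          have hQ : pQ y t = Polynomial.C y + Polynomial.C t * Polynomial.X := rfl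
          linear_combination hh + Polynomial.C t *
            (Polynomial.C g0 + Polynomial.C g1 * Polynomial.X) * hpA +
            Polynomial.C β * Polynomial.C t * hP + (Polynomial.C α * Polynomial.C t -
              Polynomial.C β * Polynomial.C t * Polynomial.X) * hQ⟩
      have key := comb_eq x y t c k (fn c g (-α) β) ![g0, g1]
      have hval : vecL c (a, b, u0, u1) =
          (∑ i, fn c g (-α) β i • vecL c (gp x y t c i)) +
          (∑ m, (![g0, g1] : Fin 2 → _) m • vecL c (wp x t k m)) := by
        rw [key, ← sub_eq_zero, ← map_sub]
        simp only [Prod.mk_sub_mk]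
        rw [vecL_zero_iff c hc2]
        obtain ⟨r, hr⟩ := fpoly_fn c g (-α) β
        have f1 : fn c g (-α) β ⟨c, by omega⟩ = -α := by simp [fn]
        have f2 : fn c g (-α) β ⟨c + 1, by omega⟩ = β := by simp [fn]
        rw [f1, f2]
        simp only [Matrix.cons_val_zero, Matrix.cons_val_one]
        refine ⟨⟨h1 - r * pQ y t, ?_⟩, ⟨h2 + r * pP x t, ?_⟩, ?_, ?_⟩
        · linear_combination e1 - pQ y t * hr
        · rw [neg_mul, map_neg]
          linear_combination e2 + pP x t * hr
        · linear_combination hu0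
        · linear_combination hu1
      rw [hval]
      apply Submodule.add_mem
      · exact Submodule.sum_mem _ fun i _ => Submodule.smul_mem _ _
          (Submodule.subset_span (Or.inl ⟨i, rfl⟩))
      · exact Submodule.sum_mem _ fun i _ => Submodule.smul_mem _ _
          (Submodule.subset_span (Or.inr ⟨i, rfl⟩))
  · refine ⟨![fn c (Polynomial.C t * pA x t k) (x ^ k) 0,
      fn c (-(Polynomial.C t * pA x t k * Polynomial.X)) 0 (-x ^ k)], ![![y, t], ![x, -y]],
      ?_, ?_, ?_, ?_, ?_⟩
    · intro l i
      rw [mem_homogeneousSubmodule]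
      fin_cases l
      · change MvPolynomial.IsHomogeneous (fn c _ _ _ i) k
        unfold fn
        split_ifs
        · exact homP_tA k hk1 _
        · exact hxkh
        · exact h0h _
      · change MvPolynomial.IsHomogeneous (fn c _ _ _ i) k
        unfold fn
        split_ifs
        · exact ((homP_tA k hk1).mul HomP.X).neg _
        · exact h0h _
        · exact hxkh.neg
    · intro l m
      rw [mem_homogeneousSubmodule]
      fin_cases l <;> fin_cases m
      · exact hX 1
      · exact hX 2
      · exact hX 0
      · exact (hX 1).neg
    · intro l
      rw [comb_eq, vecL_zero_iff c hc2]
      fin_cases l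
      · simp only [Fin.zero_eta, Matrix.cons_val_zero, Matrix.cons_val_one]
        obtain ⟨r, hr⟩ := fpoly_fn c (Polynomial.C t * pA x t k) (x ^ k) 0
        have f1 : fn c (Polynomial.C t * pA x t k) (x ^ k) 0 ⟨c, by omega⟩ = x ^ k := by simp [fn]
        have f2 : fn c (Polynomial.C t * pA x t k) (x ^ k) 0 ⟨c + 1, by omega⟩ = 0 := by simp [fn]
        rw [f1, f2]
        have hQ : pQ y t = Polynomial.C y + Polynomial.C t * Polynomial.X := rfl
        refine ⟨⟨r * pQ y t, ?_⟩, ⟨-(r * pP x t) + Polynomial.C t * Polynomial.C ((-t) ^ k), ?_⟩,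
          ?_, ?_⟩
        · rw [zero_mul, map_zero]
          linear_combination pQ y t * hr + Polynomial.C t * pA x t k * hQ
        · rw [zero_mul, map_zero, map_mul]
          linear_combination -pP x t * hr - Polynomial.C t * hpA
        · ring
        · ring
      · simp only [Fin.mk_one, Matrix.cons_val_zero, Matrix.cons_val_one]
        obtain ⟨r, hr⟩ := fpoly_fn c (-(Polynomial.C t * pA x t k * Polynomial.X)) 0 (-x ^ k)
        have f1 : fn c (-(Polynomial.C t * pA x t k * Polynomial.X)) 0 (-x ^ k)
          ⟨c, by omega⟩ = 0 := by simp [fn]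
        have f2 : fn c (-(Polynomial.C t * pA x t k * Polynomial.X)) 0 (-x ^ k)
          ⟨c + 1, by omega⟩ = -x ^ k := by simp [fn]
        rw [f1, f2]
        have hP : pP x t = Polynomial.C x + Polynomial.C t * Polynomial.X ^ 2 := rfl
        have hQ : pQ y t = Polynomial.C y + Polynomial.C t * Polynomial.X := rfl
        refine ⟨⟨r * pQ y t + Polynomial.C t * Polynomial.C ((-t) ^ k), ?_⟩,
          ⟨-(r * pP x t) - Polynomial.C t * Polynomial.C ((-t) ^ k) * Polynomial.X, ?_⟩,
          ?_, ?_⟩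
        · rw [neg_mul, map_neg, map_neg, map_mul]
          linear_combination pQ y t * hr - Polynomial.C t * hpA +
            Polynomial.C t * pA x t k * hP - Polynomial.C t * pA x t k * Polynomial.X * hQ
        · rw [zero_mul, map_zero, neg_mul, map_neg, map_mul]
          linear_combination -pP x t * hr + Polynomial.C t * Polynomial.X * hpA
        · ring
        · ring
    · rintro a ⟨hF, -⟩
      have e0 := congrFun hF ⟨c, by omega⟩
      have e1 := congrFun hF ⟨c + 1, by omega⟩
      simp [fn, hx.ne_zero] at e0 e1
      funext i
      fin_cases i
      · exact e0
      · exact e1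
    · intro f g hfg
      rw [comb_eq, vecL_zero_iff c hc2] at hfg
      obtain ⟨-, hb, h0, h1⟩ := hfg
      obtain ⟨α', β', hα, hβ, hg0, hg1⟩ := rel_lem x y t hx hxy k _ _ _ _ h0 h1
      refine ⟨![α', -β'], ?_, ?_⟩
      · have hd : Polynomial.X ^ c ∣ fpoly c f - Polynomial.C t * pA x t k *
            (Polynomial.C α' + Polynomial.C β' * Polynomial.X) := by
          apply P_cancel x t hx.ne_zero
          obtain ⟨r, hr⟩ := hb
          rw [hα, hβ] at hr
          refine ⟨-r + Polynomial.C t * Polynomial.C ((-t) ^ k) *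
            (Polynomial.C α' + Polynomial.C β' * Polynomial.X), ?_⟩
          simp only [map_mul] at hr
          linear_combination -hr - Polynomial.C t *
            (Polynomial.C α' + Polynomial.C β' * Polynomial.X) * hpA
        rw [fn_fpoly c f _ hd, hα, hβ]
        funext i
        simp only [Matrix.cons_val_zero, Matrix.cons_val_one, Pi.add_apply, Pi.smul_apply,
          smul_eq_mul, fn]
        split_ifs
        · rw [← Polynomial.coeff_C_mul, ← Polynomial.coeff_C_mul, ← Polynomial.coeff_add]
          congr 1
          rw [map_neg]; ring
        · ring
        · ring
      · funext m
        fin_cases m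
        · change g 0 = α' * y + (-β') * x
          rw [hg0]; ring
        · change g 1 = α' * t + (-β') * (-y)
          rw [hg1]; ring
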